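/- There exists a constant c > 0 such that P(there exists a pivotal site in B(r)) ≥ c uniformly in r ≥ 1. -/

import Mathlib

/-!
Critical site percolation on the triangular lattice realized on `ℤ²`.
A configuration assigns to each site `true` (open) or `false` (closed),
and `P` is the product Bernoulli(1/2) measure, axiomatized by
`IsBernoulliHalf` below (finite cylinder events have product probability).
-/

open MeasureTheory
open scoped ENNReal

/-- Sites of the lattice: vertices of `ℤ²`. -/
abbrev Site : Type := ℤ × ℤ

/-- A percolation configuration: `true` = open, `false` = closed. -/
abbrev Config : Type := Site → Bool

/-- Adjacency for the triangular lattice realized on `ℤ²`: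
the neighbors of `(x,y)` are `(x±1,y)`, `(x,y±1)`, `(x+1,y-1)`, `(x-1,y+1)`. -/
def Adj (a b : Site) : Prop :=
  (b.1 - a.1, b.2 - a.2) ∈
    ({(1, 0), (-1, 0), (0, 1), (0, -1), (1, -1), (-1, 1)} : Set (ℤ × ℤ))

/-- A (nonempty, self-avoiding) lattice path: a list of distinct sites in which
consecutive sites are neighbors. -/
def IsPath (p : List Site) : Prop := p ≠ [] ∧ p.Nodup ∧ p.Chain' Adj

/-- A path all of whose vertices lie in the set `S`. -/
def PathIn (S : Set Site) (p : List Site) : Prop := IsPath p ∧ ∀ v ∈ p, v ∈ S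

/-- All sites of `p` are open in `ω`. -/
def IsOpenOn (ω : Config) (p : List Site) : Prop := ∀ v ∈ p, ω v = true

/-- All sites of `p` are closed in `ω`. -/
def IsClosedOn (ω : Config) (p : List Site) : Prop := ∀ v ∈ p, ω v = false

/-- The first vertex of `p` lies in `A`. -/
def FirstIn (A : Set Site) (p : List Site) : Prop := ∃ a ∈ A, p.head? = some a

/-- The last vertex of `p` lies in `A`. -/
def LastIn (A : Set Site) (p : List Site) : Prop := ∃ a ∈ A, p.getLast? = some a

/-- `μ` is the product Bernoulli(1/2) measure on configurations: a probability
measure for which every finite cylinder event has the product probability. -/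
def IsBernoulliHalf (μ : Measure Config) : Prop :=
  IsProbabilityMeasure μ ∧
    ∀ (S : Finset Site) (f : Site → Bool),
      μ {ω | ∀ v ∈ S, ω v = f v} = (1 / 2 : ℝ≥0∞) ^ S.card

/-- The lattice rectangle `[x₀,x₁] × [y₀,y₁]`. -/
def rect (x₀ x₁ y₀ y₁ : ℤ) : Set Site :=
  {v | x₀ ≤ v.1 ∧ v.1 ≤ x₁ ∧ y₀ ≤ v.2 ∧ v.2 ≤ y₁}

/-- The left side of a rectangle. -/
def rectLeft (x₀ x₁ y₀ y₁ : ℤ) : Set Site := {v ∈ rect x₀ x₁ y₀ y₁ | v.1 = x₀}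

/-- The right side of a rectangle. -/
def rectRight (x₀ x₁ y₀ y₁ : ℤ) : Set Site := {v ∈ rect x₀ x₁ y₀ y₁ | v.1 = x₁}

/-- The top side of a rectangle. -/
def rectTop (x₀ x₁ y₀ y₁ : ℤ) : Set Site := {v ∈ rect x₀ x₁ y₀ y₁ | v.2 = y₁}

/-- The bottom side of a rectangle. -/
def rectBot (x₀ x₁ y₀ y₁ : ℤ) : Set Site := {v ∈ rect x₀ x₁ y₀ y₁ | v.2 = y₀}

/-- A horizontal open crossing of the rectangle `[x₀,x₁] × [y₀,y₁]`:
an open path in the rectangle from its left side to its right side. -/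
def HorizCrossing (x₀ x₁ y₀ y₁ : ℤ) (ω : Config) (p : List Site) : Prop :=
  PathIn (rect x₀ x₁ y₀ y₁) p ∧ IsOpenOn ω p ∧
    FirstIn (rectLeft x₀ x₁ y₀ y₁) p ∧ LastIn (rectRight x₀ x₁ y₀ y₁) p

/-- `v` is a pivotal site for the box `B(n) = [-n,n]²`: some horizontal open
crossing of `B(n)` contains `v`, and there are two disjoint closed paths in
`B(n)` started from `v` (i.e. starting at a neighbor of `v`), one to the top
side and one to the bottom side of `B(n)`. -/
def Pivotal (n : ℤ) (ω : Config) (v : Site) : Prop :=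
  (∃ p, HorizCrossing (-n) n (-n) n ω p ∧ v ∈ p) ∧
    ∃ q₁ q₂ : List Site,
      PathIn (rect (-n) n (-n) n) q₁ ∧ IsClosedOn ω q₁ ∧
        FirstIn {w | Adj v w} q₁ ∧ LastIn (rectTop (-n) n (-n) n) q₁ ∧
      PathIn (rect (-n) n (-n) n) q₂ ∧ IsClosedOn ω q₂ ∧
        FirstIn {w | Adj v w} q₂ ∧ LastIn (rectBot (-n) n (-n) n) q₂ ∧
      List.Disjoint q₁ q₂

/-- `Q_n`: the set of pivotal sites for `B(n)`. -/
def Qset (n : ℤ) (ω : Config) : Set Site := {v | Pivotal n ω v}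

/-! ### Reachability inside a finite set -/

/-- `Reach adj S L w`: the site `w` can be reached from `L` by steps of `adj` inside `S`. -/
inductive Reach {α : Type*} (adj : α → α → Prop) (S : Finset α) (L : Set α) : α → Prop
  | base {u : α} : u ∈ S → u ∈ L → Reach adj S L u
  | step {a b : α} : Reach adj S L a → b ∈ S → adj a b → Reach adj S L b

/-- `S` contains a path from `L` to `R`. -/
def Conn {α : Type*} (adj : α → α → Prop) (L R : Set α) (S : Finset α) : Prop :=
  ∃ w ∈ R, Reach adj S L w

section Connectivity

variable {α : Type*} {adj : α → α → Prop} {S T : Finset α} {L R : Set α}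

theorem Reach.mem {w : α} (h : Reach adj S L w) : w ∈ S := by
  cases h <;> assumption

theorem Reach.mono {w : α} (hST : S ⊆ T) (h : Reach adj S L w) : Reach adj T L w := by
  induction h with
  | base h1 h2 => exact .base (hST h1) h2
  | step _ h2 h3 ih => exact .step ih (hST h2) h3

theorem Conn.mono (hST : S ⊆ T) (h : Conn adj L R S) : Conn adj L R T := by
  obtain ⟨w, hw, h⟩ := h
  exact ⟨w, hw, h.mono hST⟩

theorem Reach.conn (hadj : ∀ a b, adj a b → adj b a) {w : α} (h : Reach adj S L w)
    (h' : Reach adj S R w) : Conn adj R L S := by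
  induction h with
  | base _ h2 => exact ⟨_, h2, h'⟩
  | step h1 _ h3 ih => exact ih (.step h' h1.mem (hadj _ _ h3))

theorem Conn.symm (hadj : ∀ a b, adj a b → adj b a) (h : Conn adj L R S) : Conn adj R L S := by
  obtain ⟨w, hw, h⟩ := h
  exact h.conn hadj (.base h.mem hw)

theorem Reach.image [DecidableEq α] {e : α → α} (he : ∀ a b, adj a b → adj (e a) (e b))
    {w : α} (h : Reach adj S L w) : Reach adj (S.image e) (e '' L) (e w) := by
  induction h with
  | base h1 h2 => exact .base (Finset.mem_image_of_mem _ h1) (Set.mem_image_of_mem _ h2)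
  | step _ h2 h3 ih => exact .step ih (Finset.mem_image_of_mem _ h2) (he _ _ h3)

theorem Conn.image [DecidableEq α] {e : α → α} (he : ∀ a b, adj a b → adj (e a) (e b))
    (h : Conn adj L R S) : Conn adj (e '' L) (e '' R) (S.image e) := by
  obtain ⟨w, hw, h⟩ := h
  exact ⟨e w, Set.mem_image_of_mem _ hw, h.image he⟩

/-- A path from `L` to `R` inside a subset of `L ∪ R` contains an edge from `L` to `R`, if
`L` and `R` are disjoint on that subset. -/
theorem Conn.exists_edge (h : Conn adj L R S) (hS : ∀ v ∈ S, v ∈ L ∨ v ∈ R)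
    (hLR : ∀ v ∈ S, v ∈ L → v ∉ R) :
    ∃ a ∈ S, a ∈ L ∧ ∃ b ∈ S, b ∈ R ∧ adj a b := by
  obtain ⟨w, hw, h⟩ := h
  induction h with
  | base h1 h2 => exact absurd hw (hLR _ h1 h2)
  | @step a b h1 h2 h3 ih =>
    rcases hS a h1.mem with ha | ha
    · exact ⟨a, h1.mem, ha, b, h2, hw, h3⟩
    · exact ih ha

theorem conn_pair [DecidableEq α] {a b : α} (ha : a ∈ L) (hb : b ∈ R) (hab : adj a b) :
    Conn adj L R {a, b} :=
  ⟨b, hb, .step (a := a) (.base (by simp) ha) (by simp) hab⟩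

/-- Inside the part of `V` that can be reached from `L` without using the separating pair
`{x, y}`, together with that pair, paths from `L` to `R` give paths from `L` to `{x, y}`. -/
theorem Reach.conn_separator [DecidableEq α] {V G : Finset α} {x y : α}
    (hG : ∀ v ∈ V, Reach adj ((V.erase x).erase y) L v ∨ v = x ∨ v = y → v ∈ G) (hSV : S ⊆ V)
    {w : α} (h : Reach adj S L w) :
    (Reach adj (S ∩ G) L w ∧ Reach adj ((V.erase x).erase y) L w) ∨
      Conn adj L {x, y} (S ∩ G) := by
  induction h with
  | @base u h1 h2 =>
    by_cases hu : u = x ∨ u = y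
    · exact .inr ⟨u, by simpa using hu,
        .base (Finset.mem_inter.2 ⟨h1, hG _ (hSV h1) (.inr hu)⟩) h2⟩
    · push Not at hu
      have hr : Reach adj ((V.erase x).erase y) L u :=
        .base (by simp [hu.1, hu.2, hSV h1]) h2
      exact .inl ⟨.base (Finset.mem_inter.2 ⟨h1, hG _ (hSV h1) (.inl hr)⟩) h2, hr⟩
  | @step a b h1 h2 h3 ih =>
    rcases ih with ⟨ih1, ih2⟩ | ih
    · by_cases hu : b = x ∨ b = y
      · exact .inr ⟨b, by simpa using hu,
          .step ih1 (Finset.mem_inter.2 ⟨h2, hG _ (hSV h2) (.inr hu)⟩) h3⟩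
      · push Not at hu
        have hr : Reach adj ((V.erase x).erase y) L b :=
          .step ih2 (by simp [hu.1, hu.2, hSV h2]) h3
        exact .inl ⟨.step ih1 (Finset.mem_inter.2 ⟨h2, hG _ (hSV h2) (.inl hr)⟩) h3, hr⟩
    · exact .inr ih

theorem exists_reach_pair {x y : α} {I J : Finset α} (hd : Disjoint I J)
    (hI : Conn adj L {x, y} I) (hJ : Conn adj L {x, y} J) :
    ∃ I' J', (I' = I ∧ J' = J ∨ I' = J ∧ J' = I) ∧ Reach adj I' L x ∧ Reach adj J' L y := by
  obtain ⟨w, hw, hI⟩ := hI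
  obtain ⟨z, hz, hJ⟩ := hJ
  rcases hw with rfl | rfl <;> rcases hz with rfl | rfl
  · exact absurd hJ.mem (Finset.disjoint_left.1 hd hI.mem)
  · exact ⟨I, J, .inl ⟨rfl, rfl⟩, hI, hJ⟩
  · exact ⟨J, I, .inr ⟨rfl, rfl⟩, hJ, hI⟩
  · exact absurd hJ.mem (Finset.disjoint_left.1 hd hI.mem)

/-- Menger's theorem for two paths: if no single site separates `L` from `R` in `V`, then `V`
contains two disjoint paths from `L` to `R`. -/
theorem exists_disjoint_conn [DecidableEq α] (hadj : ∀ a b, adj a b → adj b a) (V : Finset α)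
    (L R : Set α) (hV : Conn adj L R V) (h : ∀ v, Conn adj L R (V.erase v)) :
    ∃ I J, I ⊆ V ∧ J ⊆ V ∧ Disjoint I J ∧ Conn adj L R I ∧ Conn adj L R J := by
  classical
  induction hk : V.card using Nat.strong_induction_on generalizing V L R with
  | _ k IH =>
  subst hk
  by_cases hc : ∃ x ∈ V, x ∈ L ∧ x ∈ R
  · obtain ⟨x, hx, hxL, hxR⟩ := hc
    exact ⟨{x}, V.erase x, by simpa using hx, Finset.erase_subset _ _, by simp,
      ⟨x, hxR, .base (by simp) hxL⟩, h x⟩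
  push Not at hc
  by_cases hU : ∀ x ∈ V, x ∈ L ∨ x ∈ R
  · have edge : ∀ U ⊆ V, Conn adj L R U → ∃ a ∈ U, a ∈ L ∧ ∃ b ∈ U, b ∈ R ∧ adj a b :=
      fun U hUV hU' => hU'.exists_edge (fun v hv => hU v (hUV hv)) (fun v hv => hc v (hUV hv))
    have pair : ∀ a b a' b', a ∈ V → b ∈ V → a' ∈ V → b' ∈ V → a ∈ L → a' ∈ L → b ∈ R →
        b' ∈ R → adj a b → adj a' b' → a ≠ a' → b ≠ b' →
        ∃ I J, I ⊆ V ∧ J ⊆ V ∧ Disjoint I J ∧ Conn adj L R I ∧ Conn adj L R J := by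
      intro a b a' b' ha hb ha' hb' haL haL' hbR hbR' hab hab' h1 h2
      refine ⟨{a, b}, {a', b'}, by grind, by grind, ?_, conn_pair haL hbR hab,
        conn_pair haL' hbR' hab'⟩
      rw [Finset.disjoint_left]
      grind
    obtain ⟨y, hy, hyL, z, hz, hzR, hyz⟩ := edge V subset_rfl hV
    obtain ⟨y', hy', hyL', z', hz', hzR', hyz'⟩ := edge _ (Finset.erase_subset y V) (h y)
    obtain ⟨u, hu, huL, w, hw, hwR, huw⟩ := edge _ (Finset.erase_subset z V) (h z)
    simp only [Finset.mem_erase] at hy' hz' hu hw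
    by_cases hzz : z' = z
    · subst hzz
      by_cases huy : u = y
      · subst huy
        exact pair u w y' z' hy hw.2 hy'.2 hz huL hyL' hwR hzR huw hyz' (Ne.symm hy'.1) hw.1
      · exact pair u w y z' hu.2 hw.2 hy hz huL hyL hwR hzR huw hyz huy hw.1
    · exact pair y' z' y z hy'.2 hz'.2 hy hz hyL' hyL hzR' hzR hyz' hyz hy'.1 hzz
  push Not at hU
  obtain ⟨x, hx, hxL, hxR⟩ := hU
  by_cases h2 : ∀ v, Conn adj L R ((V.erase x).erase v)
  · obtain ⟨I, J, hI, hJ, hIJ⟩ := IH _ (Finset.card_erase_lt_of_mem hx) _ L R (h x) h2 rfl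
    exact ⟨I, J, hI.trans (Finset.erase_subset _ _), hJ.trans (Finset.erase_subset _ _), hIJ⟩
  push Not at h2
  obtain ⟨y, hy⟩ := h2
  have hyV : y ∈ V := by
    by_contra hyV
    apply hy
    rw [Finset.erase_eq_of_notMem (fun hh => hyV (Finset.mem_of_mem_erase hh))]
    exact h x
  have side : ∀ L R : Set α, Conn adj L R V → (∀ v, Conn adj L R (V.erase v)) →
      ¬ Conn adj L R ((V.erase x).erase y) → x ∉ R →
      ∃ I J, (∀ v ∈ I ∪ J, Reach adj ((V.erase x).erase y) L v ∨ v = x ∨ v = y) ∧ I ∪ J ⊆ V ∧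
        Disjoint I J ∧ Reach adj I L x ∧ Reach adj J L y := by
    intro L R hV h hy hxR
    set G := V.filter (fun v => Reach adj ((V.erase x).erase y) L v ∨ v = x ∨ v = y) with hG
    have hGm : ∀ v ∈ V, Reach adj ((V.erase x).erase y) L v ∨ v = x ∨ v = y → v ∈ G :=
      fun v hv hh => Finset.mem_filter.2 ⟨hv, hh⟩
    have key : ∀ U ⊆ V, Conn adj L R U → Conn adj L {x, y} (U ∩ G) := by
      rintro U hUV ⟨w, hw, hr⟩
      rcases hr.conn_separator hGm hUV with ⟨_, h'⟩ | h'
      · exact absurd ⟨w, hw, h'⟩ hy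
      · exact h'
    have hlt : G.card < V.card := by
      refine Finset.card_lt_card ((Finset.filter_subset _ _).ssubset_of_ne fun hGV => ?_)
      obtain ⟨w, hw, hr⟩ := h y
      have hm := hr.mem
      rw [Finset.mem_erase] at hm
      have hmG : w ∈ G := by rw [hG, hGV]; exact hm.2
      rcases (Finset.mem_filter.1 hmG).2 with h' | h' | h'
      · exact hy ⟨w, hw, h'⟩
      · exact hxR (h' ▸ hw)
      · exact hm.1 h'
    obtain ⟨I, J, hI, hJ, hIJ, hIc, hJc⟩ := IH _ hlt G L {x, y}
      ((key V subset_rfl hV).mono Finset.inter_subset_right)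
      (fun v => (key _ (Finset.erase_subset v V) (h v)).mono (by
        intro a ha
        simp only [Finset.mem_inter, Finset.mem_erase] at ha ⊢
        exact ⟨ha.1.1, ha.2⟩)) rfl
    obtain ⟨I', J', hh, hI', hJ'⟩ := exists_reach_pair hIJ hIc hJc
    have hsub : I' ∪ J' ⊆ G := by
      rcases hh with ⟨rfl, rfl⟩ | ⟨rfl, rfl⟩ <;> simp [Finset.union_subset_iff, hI, hJ]
    refine ⟨I', J', fun v hv => (Finset.mem_filter.1 (hsub hv)).2,
      hsub.trans (Finset.filter_subset _ _), ?_, hI', hJ'⟩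
    rcases hh with ⟨rfl, rfl⟩ | ⟨rfl, rfl⟩
    · exact hIJ
    · exact hIJ.symm
  obtain ⟨I, J, hIJ, hIJV, hd, hI, hJ⟩ := side L R hV h hy hxR
  obtain ⟨I', J', hIJ', hIJV', hd', hI', hJ'⟩ := side R L (hV.symm hadj)
    (fun v => (h v).symm hadj) (fun hh => hy (hh.symm hadj)) hxL
  have hcap : ∀ v, Reach adj ((V.erase x).erase y) L v →
      ¬ Reach adj ((V.erase x).erase y) R v := fun v h1 h2 => hy (h2.conn hadj h1)
  have hxx : ∀ R, ¬ Reach adj ((V.erase x).erase y) R x := fun R hh => by simpa using hh.mem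
  have hyy : ∀ R, ¬ Reach adj ((V.erase x).erase y) R y := fun R hh => by simpa using hh.mem
  refine ⟨I ∪ I', J ∪ J', by grind, by grind, ?_,
    (hI'.mono Finset.subset_union_right).conn hadj (hI.mono Finset.subset_union_left),
    (hJ'.mono Finset.subset_union_right).conn hadj (hJ.mono Finset.subset_union_left)⟩
  have m1 := hI.mem
  have m2 := hJ.mem
  have m3 := hI'.mem
  have m4 := hJ'.mem
  rw [Finset.disjoint_left] at *
  intro v hv hv'
  have e1 := hIJ v
  have e2 := hIJ' v
  have e3 := hcap v
  simp only [Finset.mem_union] at *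
  grind

end Connectivity

/-! ### The van den Berg–Kesten inequality for increasing events -/

/-- Disjoint occurrence of two increasing events. -/
def DisjointOccur {α : Type*} (A B : Finset α → Prop) (s : Finset α) : Prop :=
  ∃ I J, I ⊆ s ∧ J ⊆ s ∧ Disjoint I J ∧ A I ∧ B J

open Classical in
/-- The number of subsets of `S` in the event `A`. -/
noncomputable def eventCard {α : Type*} (S : Finset α) (A : Finset α → Prop) : ℕ :=
  (S.powerset.filter A).card

section BK

variable {α : Type*}

theorem DisjointOccur.imp {A A' B B' : Finset α → Prop} (hA : ∀ s, A s → A' s)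
    (hB : ∀ s, B s → B' s) {s : Finset α} (h : DisjointOccur A B s) : DisjointOccur A' B' s := by
  obtain ⟨I, J, h1, h2, h3, h4, h5⟩ := h
  exact ⟨I, J, h1, h2, h3, hA _ h4, hB _ h5⟩

theorem eventCard_mono {S : Finset α} {A B : Finset α → Prop} (h : ∀ s ⊆ S, A s → B s) :
    eventCard S A ≤ eventCard S B := by
  classical
  refine Finset.card_le_card fun s hs => ?_
  simp only [Finset.mem_filter, Finset.mem_powerset] at hs ⊢
  exact ⟨hs.1, h s hs.1 hs.2⟩

theorem eventCard_add_not (S : Finset α) (A : Finset α → Prop) :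
    eventCard S A + eventCard S (fun s => ¬ A s) = 2 ^ S.card := by
  classical
  unfold eventCard
  rw [← Finset.card_powerset]
  convert Finset.card_filter_add_card_filter_not (s := S.powerset) A

theorem eventCard_or_add_and (S : Finset α) (A B : Finset α → Prop) :
    eventCard S (fun s => A s ∨ B s) + eventCard S (fun s => A s ∧ B s) =
      eventCard S A + eventCard S B := by
  classical
  unfold eventCard
  rw [← Finset.card_union_add_card_inter (S.powerset.filter A)]
  congr 2 <;> ext s <;> simp only [Finset.mem_filter, Finset.mem_union, Finset.mem_inter] <;>
    tauto

theorem eventCard_insert [DecidableEq α] {S : Finset α} {a : α} (ha : a ∉ S)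
    (A : Finset α → Prop) :
    eventCard (insert a S) A = eventCard S A + eventCard S (fun s => A (insert a s)) := by
  classical
  unfold eventCard
  rw [Finset.powerset_insert, Finset.filter_union, Finset.card_union_of_disjoint]
  · congr 1
    rw [Finset.filter_image, Finset.card_image_of_injOn]
    intro s hs t ht hst
    simp only [Finset.coe_filter, Finset.mem_powerset, Set.mem_ofPred_eq] at hs ht
    have := congrArg (Finset.erase · a) hst
    simpa [Finset.erase_insert (fun h => ha (hs.1 h)),
      Finset.erase_insert (fun h => ha (ht.1 h))] using this
  · rw [Finset.disjoint_left]
    intro s hs hs'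
    simp only [Finset.mem_filter, Finset.mem_powerset, Finset.mem_image] at hs hs'
    obtain ⟨⟨t, _, rfl⟩, _⟩ := hs'
    exact ha (hs.1 (Finset.mem_insert_self _ _))

/-- The van den Berg–Kesten inequality for increasing events and the uniform measure on the
subsets of a finite set. -/
theorem eventCard_disjointOccur_mul_le [DecidableEq α] (S : Finset α) (A B : Finset α → Prop)
    (hA : ∀ s t, s ⊆ t → A s → A t) (hB : ∀ s t, s ⊆ t → B s → B t) :
    eventCard S (DisjointOccur A B) * 2 ^ S.card ≤ eventCard S A * eventCard S B := by
  classical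
  induction S using Finset.induction_on generalizing A B with
  | empty =>
    have e : ∀ C : Finset α → Prop, eventCard ∅ C = if C ∅ then 1 else 0 := by
      intro C
      unfold eventCard
      split_ifs with h <;> simp [Finset.filter_singleton, h]
    rw [e, e, e]
    split_ifs with h1 h2 h3 <;> simp
    · obtain ⟨I, J, hI, hJ, _, hI', hJ'⟩ := h1
      exact absurd (hB _ _ hJ hJ') h3
    all_goals
      obtain ⟨I, J, hI, hJ, _, hI', hJ'⟩ := h1
      exact absurd (hA _ _ hI hI') h2
  | insert a S ha IH =>
    rw [eventCard_insert ha, eventCard_insert ha A, eventCard_insert ha B,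
      Finset.card_insert_of_notMem ha]
    set A' : Finset α → Prop := fun s => A (insert a s) with hA'
    set B' : Finset α → Prop := fun s => B (insert a s) with hB'
    have hAA : ∀ s, A s → A' s := fun s => hA _ _ (Finset.subset_insert _ _)
    have hBB : ∀ s, B s → B' s := fun s => hB _ _ (Finset.subset_insert _ _)
    have mA : ∀ s t, s ⊆ t → A' s → A' t := fun s t h => hA _ _ (Finset.insert_subset_insert a h)
    have mB : ∀ s t, s ⊆ t → B' s → B' t := fun s t h => hB _ _ (Finset.insert_subset_insert a h)
    have i1 := IH A' B mA hB
    have i2 := IH A B' hA mB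
    have hle : eventCard S (fun s => DisjointOccur A B (insert a s)) ≤
        eventCard S (fun s => DisjointOccur A' B s ∨ DisjointOccur A B' s) := by
      refine eventCard_mono fun s hs => ?_
      rintro ⟨I, J, hI, hJ, hIJ, hAI, hBJ⟩
      by_cases haI : a ∈ I
      · have haJ : a ∉ J := Finset.disjoint_left.1 hIJ haI
        refine .inl ⟨I.erase a, J, Finset.subset_insert_iff.1 hI,
          (Finset.subset_insert_iff_of_notMem haJ).1 hJ,
          hIJ.mono_left (Finset.erase_subset _ _), ?_, hBJ⟩
        simpa [hA', Finset.insert_erase haI] using hAI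
      · refine .inr ⟨I, J.erase a, (Finset.subset_insert_iff_of_notMem haI).1 hI,
          Finset.subset_insert_iff.1 hJ,
          hIJ.mono_right (Finset.erase_subset _ _), hAI, ?_⟩
        exact hB _ _ (Finset.insert_erase_subset a J) hBJ
    have hand : eventCard S (DisjointOccur A B) ≤
        eventCard S (fun s => DisjointOccur A' B s ∧ DisjointOccur A B' s) :=
      eventCard_mono fun s _ h => ⟨h.imp hAA fun _ => id, h.imp (fun _ => id) hBB⟩
    have hor := eventCard_or_add_and S (DisjointOccur A' B) (DisjointOccur A B')
    have a01 : eventCard S A ≤ eventCard S A' := eventCard_mono fun s _ => hAA s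
    have b01 : eventCard S B ≤ eventCard S B' := eventCard_mono fun s _ => hBB s
    have htot : eventCard S (DisjointOccur A B) +
        eventCard S (fun s => DisjointOccur A B (insert a s)) ≤
        eventCard S (DisjointOccur A' B) + eventCard S (DisjointOccur A B') := by omega
    have := Nat.mul_le_mul_right (2 ^ S.card) htot
    rw [pow_succ]
    generalize eventCard S A = a0 at *
    generalize eventCard S A' = a1 at *
    generalize eventCard S B = b0 at *
    generalize eventCard S B' = b1 at *
    obtain ⟨a1, rfl⟩ := Nat.exists_eq_add_of_le a01
    obtain ⟨b1, rfl⟩ := Nat.exists_eq_add_of_le b01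
    nlinarith [Nat.zero_le (a1 * b1)]

end BK

/-! ### Crossings of a square -/

/-- The square `[-n, n]²` as a finite set. -/
noncomputable def squareBox (n : ℤ) : Finset Site := Finset.Icc (-n) n ×ˢ Finset.Icc (-n) n

/-- The set `s` of sites contains a path from the column `-n` to the column `n`. -/
def HorizConn (n : ℤ) (s : Finset Site) : Prop := Conn Adj {v | v.1 = -n} {v | v.1 = n} s

/-- The set `s` of sites contains a path from the row `-n` to the row `n`. -/
def VertConn (n : ℤ) (s : Finset Site) : Prop := Conn Adj {v | v.2 = -n} {v | v.2 = n} s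

theorem mem_squareBox {n : ℤ} {v : Site} :
    v ∈ squareBox n ↔ (-n ≤ v.1 ∧ v.1 ≤ n) ∧ -n ≤ v.2 ∧ v.2 ≤ n := by
  simp [squareBox]

theorem adj_iff {a b : Site} : Adj a b ↔
    b.1 = a.1 + 1 ∧ b.2 = a.2 ∨ b.1 = a.1 - 1 ∧ b.2 = a.2 ∨ b.1 = a.1 ∧ b.2 = a.2 + 1 ∨
      b.1 = a.1 ∧ b.2 = a.2 - 1 ∨ b.1 = a.1 + 1 ∧ b.2 = a.2 - 1 ∨
      b.1 = a.1 - 1 ∧ b.2 = a.2 + 1 := by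
  simp only [Adj, Set.mem_insert_iff, Set.mem_singleton_iff, Prod.mk.injEq]
  omega

theorem adj_symm (a b : Site) (h : Adj a b) : Adj b a := by
  rw [adj_iff] at *
  omega

theorem adj_swap (a b : Site) (h : Adj a b) : Adj a.swap b.swap := by
  rw [adj_iff] at *
  simp only [Prod.fst_swap, Prod.snd_swap]
  omega

/-- Two adjacent sites in canonical order: `w` lies above `v` or in the column to the right. -/
def AdjStep (v w : Site) : Prop :=
  w.1 = v.1 + 1 ∧ (w.2 = v.2 ∨ w.2 = v.2 - 1) ∨ w.1 = v.1 ∧ w.2 = v.2 + 1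

theorem Adj.adjStep_or {v w : Site} (h : Adj v w) : AdjStep v w ∨ AdjStep w v := by
  rw [adj_iff] at h
  unfold AdjStep
  omega

/-- Indicator that the edge `ab` crosses the upward ray from `v`, which is slightly shifted to
the right. -/
def rayCross (v a b : Site) : ZMod 2 :=
  if a.1 = v.1 ∧ b.1 = v.1 + 1 ∧ v.2 < a.2 ∨ b.1 = v.1 ∧ a.1 = v.1 + 1 ∧ v.2 < b.2 then 1 else 0

/-- Indicator that `c` lies strictly between the upward rays from `v` and `w`. -/
def betweenRays (v w c : Site) : ZMod 2 :=
  if w.1 = v.1 + 1 ∧ c.1 = w.1 ∧ w.2 < c.2 then 1 else 0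

set_option maxHeartbeats 1000000 in
theorem rayCross_add {v w a b : Site} (hvw : AdjStep v w) (hab : Adj a b) (hav : a ≠ v)
    (haw : a ≠ w) (hbv : b ≠ v) (hbw : b ≠ w) :
    rayCross v a b + rayCross w a b = betweenRays v w a + betweenRays v w b := by
  obtain ⟨v1, v2⟩ := v
  obtain ⟨w1, w2⟩ := w
  obtain ⟨a1, a2⟩ := a
  obtain ⟨b1, b2⟩ := b
  rw [adj_iff] at hab
  simp only [AdjStep, rayCross, betweenRays, ne_eq, Prod.mk.injEq] at *
  rcases hvw with ⟨rfl, rfl | rfl⟩ | ⟨rfl, rfl⟩ <;>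
    rcases hab with ⟨rfl, rfl⟩ | ⟨rfl, rfl⟩ | ⟨rfl, rfl⟩ | ⟨rfl, rfl⟩ | ⟨rfl, rfl⟩ | ⟨rfl, rfl⟩ <;>
    split_ifs <;> first | rfl | (exfalso; omega)

theorem rayCross_of_le {v a b : Site} (ha : a.2 ≤ v.2) (hb : b.2 ≤ v.2) : rayCross v a b = 0 := by
  unfold rayCross
  rw [if_neg]
  omega

theorem rayCross_bottom {v a b : Site} (hab : Adj a b) (ha : v.2 ≤ a.2) (hb : v.2 ≤ b.2)
    (hav : a ≠ v) (hbv : b ≠ v) :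
    rayCross v a b = (if a.1 ≤ v.1 then 1 else 0) + (if b.1 ≤ v.1 then 1 else 0) := by
  obtain ⟨v1, v2⟩ := v
  obtain ⟨a1, a2⟩ := a
  obtain ⟨b1, b2⟩ := b
  rw [adj_iff] at hab
  simp only [rayCross, ne_eq, Prod.mk.injEq] at *
  split_ifs <;> first | decide | (exfalso; omega)

theorem exists_side_of_reach {n : ℤ} {s : Finset Site} (hs : s ⊆ squareBox n) {c : Site}
    (h : Reach Adj s {v | v.1 = -n} c) :
    ∃ F : Site → ZMod 2,
      (∀ v ∈ squareBox n \ s, ∀ w ∈ squareBox n \ s, AdjStep v w → F v + F w = betweenRays v w c) ∧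
      (∀ v, v.2 = n → F v = 0) ∧
      ∀ v ∈ squareBox n \ s, v.2 = -n → F v = 1 + if c.1 ≤ v.1 then 1 else 0 := by
  have ne : ∀ {x v}, x ∈ s → v ∈ squareBox n \ s → x ≠ v := fun hx hv hxv =>
    (Finset.mem_sdiff.1 hv).2 (hxv ▸ hx)
  have box : ∀ {v}, v ∈ squareBox n \ s → (-n ≤ v.1 ∧ v.1 ≤ n) ∧ -n ≤ v.2 ∧ v.2 ≤ n := fun hv =>
    mem_squareBox.1 (Finset.mem_sdiff.1 hv).1
  induction h with
  | @base u h1 h2 =>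
    have hadj : Adj (u.1 - 1, u.2) u := by rw [adj_iff]; simp
    have hu := mem_squareBox.1 (hs h1)
    have h2' : u.1 = -n := h2
    have ne' : ∀ {v}, v ∈ squareBox n \ s → (u.1 - 1, u.2) ≠ v := by
      rintro v hv rfl
      have := box hv
      simp only at this
      omega
    refine ⟨fun v => rayCross v (u.1 - 1, u.2) u, fun v hv w hw hvw => ?_, fun v hv => ?_,
      fun v hv hv' => ?_⟩
    · rw [rayCross_add hvw hadj (ne' hv) (ne' hw) (ne h1 hv) (ne h1 hw)]
      have := box hw
      have h0 : betweenRays v w (u.1 - 1, u.2) = 0 := by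
        unfold betweenRays
        rw [if_neg]
        simp only
        omega
      rw [h0, zero_add]
    · exact rayCross_of_le (by simp only; omega) (by omega)
    · have := box hv
      change rayCross v _ u = _
      rw [rayCross_bottom hadj (by simp only; omega) (by omega) (ne' hv) (ne h1 hv),
        if_pos (by simp only; omega)]
  | @step a b h1 h2 h3 ih =>
    obtain ⟨F, hF, hF1, hF2⟩ := ih
    have ha := mem_squareBox.1 (hs h1.mem)
    have hb := mem_squareBox.1 (hs h2)
    refine ⟨fun v => F v + rayCross v a b, fun v hv w hw hvw => ?_, fun v hv => ?_,
      fun v hv hv' => ?_⟩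
    · rw [add_add_add_comm, hF v hv w hw hvw,
        rayCross_add hvw h3 (ne h1.mem hv) (ne h1.mem hw) (ne h2 hv) (ne h2 hw), ← add_assoc,
        CharTwo.add_self_eq_zero, zero_add]
    · simp only [hF1 v hv, rayCross_of_le (v := v) (a := a) (b := b) (by omega) (by omega),
        add_zero]
    · simp only
      rw [hF2 v hv hv', rayCross_bottom h3 (by omega) (by omega) (ne h1.mem hv) (ne h2 hv),
        add_assoc, ← add_assoc (ite _ _ _) (ite _ _ _), CharTwo.add_self_eq_zero, zero_add]

/-- A horizontal crossing and a vertical crossing of a square meet. -/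
theorem HorizConn.not_vertConn {n : ℤ} {s : Finset Site} (hs : s ⊆ squareBox n)
    (h : HorizConn n s) : ¬ VertConn n (squareBox n \ s) := by
  rintro ⟨t, ht, hv⟩
  obtain ⟨c, hc, hh⟩ := h
  obtain ⟨F, hF, hF1, hF2⟩ := exists_side_of_reach hs hh
  have hcs := hh.mem
  have hcb := mem_squareBox.1 (hs hcs)
  have hadj : Adj c (c.1 + 1, c.2) := by rw [adj_iff]; simp
  change c.1 = n at hc
  change t.2 = n at ht
  have box : ∀ {v}, v ∈ squareBox n \ s → (-n ≤ v.1 ∧ v.1 ≤ n) ∧ -n ≤ v.2 ∧ v.2 ≤ n := fun hv =>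
    mem_squareBox.1 (Finset.mem_sdiff.1 hv).1
  have ne : ∀ {v}, v ∈ squareBox n \ s → c ≠ v := fun hv hxv =>
    (Finset.mem_sdiff.1 hv).2 (hxv ▸ hcs)
  have ne' : ∀ {v}, v ∈ squareBox n \ s → (c.1 + 1, c.2) ≠ v := by
    rintro v hv rfl
    have := box hv
    simp only at this
    omega
  set G : Site → ZMod 2 := fun v => F v + rayCross v c (c.1 + 1, c.2) with hG
  have hstep : ∀ v ∈ squareBox n \ s, ∀ w ∈ squareBox n \ s, AdjStep v w → G v = G w := by
    intro v hv w hw hvw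
    rw [← CharTwo.add_eq_zero]
    simp only [hG]
    rw [add_add_add_comm, hF v hv w hw hvw, rayCross_add hvw hadj (ne hv) (ne hw) (ne' hv) (ne' hw),
      ← add_assoc, CharTwo.add_self_eq_zero, zero_add]
    have := box hw
    unfold betweenRays
    rw [if_neg]
    simp only
    omega
  have hone : ∀ w, Reach Adj (squareBox n \ s) {v | v.2 = -n} w → G w = 1 := by
    intro w hw
    induction hw with
    | @base u h1 h2 =>
      have := box h1
      change u.2 = -n at h2
      simp only [hG]
      rw [hF2 u h1 h2, rayCross_bottom hadj (by omega) (by simp only; omega) (ne h1) (ne' h1),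
        if_neg (by simp only; omega : ¬ (c.1 + 1, c.2).1 ≤ u.1), add_zero, add_assoc,
        CharTwo.add_self_eq_zero, add_zero]
    | @step a b h1 h2 h3 ih =>
      rcases h3.adjStep_or with h | h
      · rw [← hstep a h1.mem b h2 h, ih]
      · rw [hstep b h2 a h1.mem h, ih]
  have h1 := hone t hv
  simp only [hG] at h1
  rw [hF1 t ht, rayCross_of_le (by omega) (by simp only; omega), add_zero] at h1
  exact absurd h1 (by decide)

theorem sum_boundary_eq_zero (M : ℕ) (H V : ℕ → ℕ → ZMod 2)
    (h : ∀ i < M, ∀ j < M, H i j + H i (j + 1) + (V i j + V (i + 1) j) = 0) :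
    ∑ i ∈ Finset.range M, (H i M + H i 0) + ∑ j ∈ Finset.range M, (V M j + V 0 j) = 0 := by
  have tel : ∀ f : ℕ → ZMod 2, f M + f 0 = ∑ i ∈ Finset.range M, (f i + f (i + 1)) := by
    intro f
    have := Finset.sum_range_sub f M
    rw [CharTwo.sub_eq_add] at this
    rw [← this]
    exact Finset.sum_congr rfl fun i _ => by rw [CharTwo.sub_eq_add, add_comm]
  rw [Finset.sum_congr rfl fun i _ => tel (H i),
    Finset.sum_congr rfl fun j _ => tel fun i => V i j, Finset.sum_comm (s := Finset.range M),
    ← Finset.sum_add_distrib]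
  refine Finset.sum_eq_zero fun j hj => ?_
  rw [← Finset.sum_add_distrib]
  exact Finset.sum_eq_zero fun i hi => h i (Finset.mem_range.1 hi) j (Finset.mem_range.1 hj)

/-- Indicator that an edge with endpoints labelled `i`, `j` is labelled `{0, 1}`. -/
def edgeLabel (i j : Fin 3) : ZMod 2 := if i = 0 ∧ j = 1 ∨ i = 1 ∧ j = 0 then 1 else 0

theorem edgeLabel_triangle : ∀ i j k : Fin 3, ¬ (i ≠ j ∧ j ≠ k ∧ i ≠ k) →
    edgeLabel i j + edgeLabel j k + edgeLabel i k = 0 := by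
  decide

open Classical in
/-- The labelling of the square and its outer boundary used in the proof of the Hex theorem:
`0` for sites connected to the left within `s`, `1` for sites connected to the bottom within the
complement of `s`, and `2` for the remaining sites. -/
noncomputable def hexLabel (n : ℤ) (s : Finset Site) (v : Site) : Fin 3 :=
  if v.1 < -n then 0
  else if v.2 < -n then 1
  else if Reach Adj s {v | v.1 = -n} v then 0
  else if Reach Adj (squareBox n \ s) {v | v.2 = -n} v then 1
  else 2

section Hex

variable {n : ℤ} {s : Finset Site} {v w : Site}

theorem hexLabel_eq_zero (h : hexLabel n s v = 0) :
    v.1 < -n ∨ Reach Adj s {v | v.1 = -n} v := by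
  unfold hexLabel at h
  grind

theorem hexLabel_eq_one (h : hexLabel n s v = 1) :
    (-n ≤ v.1 ∧ v.2 < -n) ∨ Reach Adj (squareBox n \ s) {v | v.2 = -n} v := by
  unfold hexLabel at h
  grind

theorem hexLabel_eq_two (h : hexLabel n s v = 2) :
    -n ≤ v.1 ∧ -n ≤ v.2 ∧ ¬ Reach Adj s {v | v.1 = -n} v ∧
      ¬ Reach Adj (squareBox n \ s) {v | v.2 = -n} v := by
  unfold hexLabel at h
  split_ifs at h with h1 h2 h3 h4
  all_goals first | exact absurd h (by decide) | exact ⟨not_lt.1 h1, not_lt.1 h2, h3, h4⟩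

theorem hexLabel_two_adj (hn : 0 ≤ n) (hs : s ⊆ squareBox n) (hH : ¬ HorizConn n s)
    (hV : ¬ VertConn n (squareBox n \ s)) (h : hexLabel n s v = 2) :
    (∀ u, Adj u v → hexLabel n s u ≠ 0) ∨ ∀ u, Adj u v → hexLabel n s u ≠ 1 := by
  obtain ⟨h1, h2, h3, h4⟩ := hexLabel_eq_two h
  by_cases hbox : v ∈ squareBox n
  · by_cases hvs : v ∈ s
    · refine .inl fun u hu h0 => ?_
      rcases hexLabel_eq_zero h0 with h0 | h0
      · rw [adj_iff] at hu
        exact h3 (.base hvs (by change v.1 = -n; omega))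
      · exact h3 (.step h0 hvs hu)
    · have hvs' : v ∈ squareBox n \ s := Finset.mem_sdiff.2 ⟨hbox, hvs⟩
      refine .inr fun u hu h0 => ?_
      rcases hexLabel_eq_one h0 with h0 | h0
      · rw [adj_iff] at hu
        exact h4 (.base hvs' (by change v.2 = -n; omega))
      · exact h4 (.step h0 hvs' hu)
  · rw [mem_squareBox] at hbox
    by_cases hv : n < v.1
    · refine .inl fun u hu h0 => ?_
      rw [adj_iff] at hu
      rcases hexLabel_eq_zero h0 with h0 | h0
      · omega
      · have := mem_squareBox.1 (hs h0.mem)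
        exact hH ⟨u, by change u.1 = n; omega, h0⟩
    · refine .inr fun u hu h0 => ?_
      rw [adj_iff] at hu
      rcases hexLabel_eq_one h0 with h0 | h0
      · omega
      · have := mem_squareBox.1 (Finset.mem_sdiff.1 h0.mem).1
        exact hV ⟨u, by change u.2 = n; omega, h0⟩

theorem hexLabel_triangle (hn : 0 ≤ n) (hs : s ⊆ squareBox n) (hH : ¬ HorizConn n s)
    (hV : ¬ VertConn n (squareBox n \ s)) {a b c : Site} (hab : Adj a b) (hbc : Adj b c)
    (hac : Adj a c) :
    edgeLabel (hexLabel n s a) (hexLabel n s b) + edgeLabel (hexLabel n s b) (hexLabel n s c) +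
      edgeLabel (hexLabel n s a) (hexLabel n s c) = 0 := by
  apply edgeLabel_triangle
  have key := fun v => hexLabel_two_adj (v := v) hn hs hH hV
  have ha := key a
  have hb := key b
  have hc := key c
  have h1 := adj_symm _ _ hab
  have h2 := adj_symm _ _ hbc
  have h3 := adj_symm _ _ hac
  rintro ⟨e1, e2, e3⟩
  have cover : ∀ i j k : Fin 3, i ≠ j → j ≠ k → i ≠ k →
      (i = 2 ∧ (j = 0 ∧ k = 1 ∨ j = 1 ∧ k = 0)) ∨ (j = 2 ∧ (i = 0 ∧ k = 1 ∨ i = 1 ∧ k = 0)) ∨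
      (k = 2 ∧ (i = 0 ∧ j = 1 ∨ i = 1 ∧ j = 0)) := by decide
  rcases cover _ _ _ e1 e2 e3 with ⟨h, h'⟩ | ⟨h, h'⟩ | ⟨h, h'⟩
  · rcases ha h with h'' | h'' <;> grind
  · rcases hb h with h'' | h'' <;> grind
  · rcases hc h with h'' | h'' <;> grind

/-- The Hex theorem: a square has a horizontal crossing in `s` or a vertical crossing in the
complement of `s`. -/
theorem horizConn_or_vertConn (hn : 0 ≤ n) (hs : s ⊆ squareBox n) :
    HorizConn n s ∨ VertConn n (squareBox n \ s) := by
  by_contra hcon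
  push Not at hcon
  obtain ⟨hH, hV⟩ := hcon
  obtain ⟨M, hM⟩ : ∃ M : ℕ, (M : ℤ) = 2 * n + 1 := ⟨(2 * n + 1).toNat, by omega⟩
  set f : ℕ → ℕ → Fin 3 := fun i j => hexLabel n s (-n - 1 + i, -n - 1 + j) with hf
  have hsum := sum_boundary_eq_zero (M + 1) (fun i j => edgeLabel (f i j) (f (i + 1) j))
    (fun i j => edgeLabel (f i j) (f i (j + 1))) (by
      intro i _ j _
      have t1 := hexLabel_triangle hn hs hH hV (a := (-n - 1 + i, -n - 1 + j))
        (b := (-n - 1 + (i + 1 : ℕ), -n - 1 + j)) (c := (-n - 1 + i, -n - 1 + (j + 1 : ℕ)))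
        (by rw [adj_iff]; push_cast; omega) (by rw [adj_iff]; push_cast; omega)
        (by rw [adj_iff]; push_cast; omega)
      have t2 := hexLabel_triangle hn hs hH hV (a := (-n - 1 + i, -n - 1 + (j + 1 : ℕ)))
        (b := (-n - 1 + (i + 1 : ℕ), -n - 1 + (j + 1 : ℕ)))
        (c := (-n - 1 + (i + 1 : ℕ), -n - 1 + j))
        (by rw [adj_iff]; push_cast; omega) (by rw [adj_iff]; push_cast; omega)
        (by rw [adj_iff]; push_cast; omega)
      have comm : ∀ i j : Fin 3, edgeLabel i j = edgeLabel j i := by decide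
      simp only [hf]
      rw [comm (hexLabel n s (-n - 1 + (i + 1 : ℕ), -n - 1 + j))] at t1
      rw [comm (hexLabel n s (-n - 1 + (i + 1 : ℕ), -n - 1 + (j + 1 : ℕ)))] at t2
      linear_combination t1 + t2 - CharTwo.two_eq_zero (R := ZMod 2) * edgeLabel
        (hexLabel n s (-n - 1 + i, -n - 1 + (j + 1 : ℕ)))
        (hexLabel n s (-n - 1 + (i + 1 : ℕ), -n - 1 + j)))
  have left : ∀ j, f 0 j = 0 := by
    intro j
    simp [hf, hexLabel]
  have bottom : ∀ i, f (i + 1) 0 = 1 := by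
    intro i
    simp only [hf, hexLabel]
    rw [if_neg (by push_cast; omega), if_pos (by push_cast; omega)]
  have right : ∀ j, f (M + 1) j ≠ 0 := by
    intro j h0
    rcases hexLabel_eq_zero h0 with h0 | h0
    · push_cast at h0
      omega
    · have := mem_squareBox.1 (hs h0.mem)
      push_cast at this
      omega
  have top : ∀ i, f i (M + 1) ≠ 1 := by
    intro i h0
    rcases hexLabel_eq_one h0 with h0 | h0
    · push_cast at h0
      omega
    · have := mem_squareBox.1 (Finset.mem_sdiff.1 h0.mem).1
      push_cast at this
      omega
  have z0 : ∀ i j : Fin 3, i ≠ 0 → j ≠ 0 → edgeLabel i j = 0 := by decide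
  have z1 : ∀ i j : Fin 3, i ≠ 1 → j ≠ 1 → edgeLabel i j = 0 := by decide
  have sides : ∑ j ∈ Finset.range (M + 1), (edgeLabel (f (M + 1) j) (f (M + 1) (j + 1)) +
      edgeLabel (f 0 j) (f 0 (j + 1))) = 0 :=
    Finset.sum_eq_zero fun j _ => by rw [z0 _ _ (right _) (right _), left, left]; rfl
  rw [sides, add_zero, Finset.sum_range_succ', Finset.sum_eq_zero, z1 _ _ (top _) (top _), left,
    bottom] at hsum
  · exact absurd hsum (by decide)
  · intro i _
    rw [z1 _ _ (top _) (top _), bottom, bottom]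
    rfl

end Hex

/-! ### Counting configurations without two disjoint crossings -/

theorem eventCard_comp {α : Type*} {S : Finset α} {e : Finset α → Finset α}
    (he : ∀ s ⊆ S, e s ⊆ S) (hee : ∀ s ⊆ S, e (e s) = s) (A : Finset α → Prop) :
    eventCard S (fun s => A (e s)) = eventCard S A := by
  classical
  unfold eventCard
  refine Finset.card_nbij' e e ?_ ?_ ?_ ?_
  · intro s hs
    simp only [Finset.coe_filter, Finset.mem_powerset, Set.mem_ofPred_eq] at hs ⊢
    exact ⟨he s hs.1, hs.2⟩
  · intro s hs
    simp only [Finset.coe_filter, Finset.mem_powerset, Set.mem_ofPred_eq] at hs ⊢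
    exact ⟨he s hs.1, by rw [hee s hs.1]; exact hs.2⟩
  · intro s hs
    simp only [Finset.coe_filter, Finset.mem_powerset, Set.mem_ofPred_eq] at hs
    exact hee s hs.1
  · intro s hs
    simp only [Finset.coe_filter, Finset.mem_powerset, Set.mem_ofPred_eq] at hs
    exact hee s hs.1

theorem horizConn_image_swap {n : ℤ} {s : Finset Site} :
    HorizConn n (s.image Prod.swap) ↔ VertConn n s := by
  have hcoord : ∀ m : ℤ, Prod.swap '' {v : Site | v.1 = m} = {v | v.2 = m} ∧
      Prod.swap '' {v : Site | v.2 = m} = {v | v.1 = m} := by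
    intro m
    simp [Set.image_swap_eq_preimage_swap]
  constructor <;> intro h
  · have h' := Conn.image adj_swap h
    rw [(hcoord _).1, (hcoord _).1, Finset.image_image, Prod.swap_swap_eq, Finset.image_id] at h'
    exact h'
  · have h' := Conn.image adj_swap h
    rw [(hcoord _).2, (hcoord _).2] at h'
    exact h'

theorem two_mul_eventCard_horizConn {n : ℤ} (hn : 0 ≤ n) :
    2 * eventCard (squareBox n) (HorizConn n) = 2 ^ (squareBox n).card := by
  rw [← eventCard_add_not _ (HorizConn n), two_mul]
  congr 1
  have hvert : eventCard (squareBox n) (fun s => VertConn n (squareBox n \ s)) =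
      eventCard (squareBox n) (VertConn n) :=
    eventCard_comp (fun s _ => Finset.sdiff_subset)
      (fun s hs => Finset.sdiff_sdiff_eq_self hs) (VertConn n)
  have hhoriz : eventCard (squareBox n) (fun s => HorizConn n (s.image Prod.swap)) =
      eventCard (squareBox n) (HorizConn n) := by
    refine eventCard_comp (fun s hs v hv => ?_) (fun s _ => ?_) (HorizConn n)
    · obtain ⟨u, hu, rfl⟩ := Finset.mem_image.1 hv
      have := mem_squareBox.1 (hs hu)
      exact mem_squareBox.2 ⟨this.2, this.1⟩
    · rw [Finset.image_image, Prod.swap_swap_eq, Finset.image_id]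
  simp only [horizConn_image_swap] at hhoriz
  rw [← hhoriz]
  refine hvert.symm.trans (le_antisymm ?_ ?_)
  · exact eventCard_mono fun s hs hV hH => hH.not_vertConn hs hV
  · exact eventCard_mono fun s hs hH => (horizConn_or_vertConn hn hs).resolve_left hH

/-- The set `s` contains a horizontal crossing but no two disjoint ones. -/
def UniqueHorizConn (n : ℤ) (s : Finset Site) : Prop :=
  HorizConn n s ∧ ¬ DisjointOccur (HorizConn n) (HorizConn n) s

theorem two_pow_card_le_eventCard_uniqueHorizConn {n : ℤ} (hn : 0 ≤ n) :
    2 ^ (squareBox n).card ≤ 4 * eventCard (squareBox n) (UniqueHorizConn n) := by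
  have hmono : ∀ s t, s ⊆ t → HorizConn n s → HorizConn n t := fun s t h => Conn.mono h
  have ha := two_mul_eventCard_horizConn hn
  have hBK := eventCard_disjointOccur_mul_le (squareBox n) _ _ hmono hmono
  have hle : eventCard (squareBox n) (HorizConn n) ≤ eventCard (squareBox n) (fun s =>
      UniqueHorizConn n s ∨ DisjointOccur (HorizConn n) (HorizConn n) s) :=
    eventCard_mono fun s _ h => by
      by_cases hd : DisjointOccur (HorizConn n) (HorizConn n) s
      · exact .inr hd
      · exact .inl ⟨h, hd⟩
  have hor := eventCard_or_add_and (squareBox n) (UniqueHorizConn n)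
    (DisjointOccur (HorizConn n) (HorizConn n))
  have hpos : 0 < 2 ^ (squareBox n).card := by positivity
  generalize eventCard (squareBox n) (HorizConn n) = a at *
  generalize eventCard (squareBox n) (DisjointOccur (HorizConn n) (HorizConn n)) = d at *
  rw [← ha] at hBK hpos ⊢
  have : d * 2 ≤ a := by
    by_contra hlt
    nlinarith
  omega

/-! ### Paths as lists -/

theorem Reach.exists_isPath {S : Finset Site} {L : Set Site} {w : Site} (h : Reach Adj S L w) :
    ∃ p, IsPath p ∧ (∀ v ∈ p, v ∈ S) ∧ FirstIn L p ∧ p.getLast? = some w := by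
  induction h with
  | @base u h1 h2 => exact ⟨[u], ⟨by simp, by simp, List.isChain_singleton u⟩, by simpa,
     ⟨u, h2, rfl⟩, rfl⟩
  | @step a b h1 h2 h3 ih =>
    obtain ⟨p, ⟨hne, hnd, hch⟩, hS, hL, hlast⟩ := ih
    by_cases hb : b ∈ p
    · obtain ⟨p1, p2, rfl⟩ := List.append_of_mem hb
      refine ⟨p1 ++ [b], ⟨by simp, ?_, ?_⟩, ?_, ?_, by simp⟩
      · exact hnd.sublist (by simp)
      · rw [List.append_cons] at hch
        exact List.IsChain.left_of_append hch
      · intro v hv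
        exact hS v (by simp at hv ⊢; tauto)
      · obtain ⟨u, hu, hh⟩ := hL
        refine ⟨u, hu, ?_⟩
        cases p1 <;> simpa using hh
    · refine ⟨p ++ [b], ⟨by simp, ?_, ?_⟩, ?_, ?_, by simp⟩
      · rw [List.nodup_append]
        grind
      · refine List.IsChain.append hch (by simp) ?_
        simp [hlast, h3]
      · intro v hv
        rcases List.mem_append.1 hv with hv | hv
        · exact hS v hv
        · rw [List.mem_singleton.1 hv]
          exact h2
      · obtain ⟨u, hu, hh⟩ := hL
        exact ⟨u, hu, by simp [List.head?_append, hh]⟩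

theorem Conn.exists_isPath {S : Finset Site} {L R : Set Site} (h : Conn Adj L R S) :
    ∃ p, IsPath p ∧ (∀ v ∈ p, v ∈ S) ∧ FirstIn L p ∧ LastIn R p := by
  obtain ⟨w, hw, h⟩ := h
  obtain ⟨p, h1, h2, h3, h4⟩ := h.exists_isPath
  exact ⟨p, h1, h2, h3, w, hw, h4⟩

theorem Reach.of_isChain {S : Finset Site} {L : Set Site} {u w : Site} {p : List Site}
    (h : Reach Adj S L u) (hch : (u :: p).IsChain Adj) (hS : ∀ v ∈ p, v ∈ S)
    (hw : (u :: p).getLast? = some w) : Reach Adj S L w := by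
  induction p generalizing u with
  | nil =>
    obtain rfl : u = w := by simpa using hw
    exact h
  | cons b p ih =>
    rw [List.isChain_cons_cons] at hch
    exact ih (h.step (hS b (by simp)) hch.1) hch.2 (fun v hv => hS v (by simp [hv]))
      (by simpa using hw)

theorem IsPath.conn {S : Finset Site} {L R : Set Site} {p : List Site} (hp : IsPath p)
    (hS : ∀ v ∈ p, v ∈ S) (hL : FirstIn L p) (hR : LastIn R p) : Conn Adj L R S := by
  obtain ⟨w, hw, hlast⟩ := hR
  obtain ⟨u, hu, hhead⟩ := hL
  obtain ⟨-, -, hch⟩ := hp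
  obtain ⟨q, rfl⟩ := List.head?_eq_some_iff.1 hhead
  exact ⟨w, hw, (Reach.base (hS u (by simp)) hu).of_isChain hch
    (fun v hv => hS v (by simp [hv])) hlast⟩

theorem IsPath.reverse {p : List Site} (hp : IsPath p) : IsPath p.reverse := by
  obtain ⟨hne, hnd, hch⟩ := hp
  exact ⟨by simpa, by simpa, List.isChain_reverse.2 (hch.imp fun a b h => adj_symm a b h)⟩

/-- Lengthening a path by one vertex at each end. -/
theorem IsPath.extend {p : List Site} {a b : Site} (hp : IsPath p) (ha : a ∉ p) (hb : b ∉ p)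
    (hab : a ≠ b) (hhead : FirstIn {u | Adj a u} p) (hlast : LastIn {u | Adj u b} p) :
    IsPath (a :: (p ++ [b])) := by
  obtain ⟨u, hu, hhead⟩ := hhead
  obtain ⟨w, hw, hlast⟩ := hlast
  obtain ⟨hne, hnd, hch⟩ := hp
  refine ⟨by simp, ?_, ?_⟩
  · rw [List.nodup_cons, List.nodup_append]
    grind
  · refine List.isChain_cons.2 ⟨?_, hch.append (by simp) ?_⟩
    · intro v hv
      have : u = v := by simpa [List.head?_append, hhead] using hv
      exact this ▸ hu
    · intro v hv x hx
      have e1 : w = v := by simpa [hlast] using hv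
      have e2 : b = x := by simpa using hx
      exact e1 ▸ e2 ▸ hw

theorem IsPath.of_append_cons {p q : List Site} {v : Site} (h : IsPath (p ++ v :: q))
    (hq : q ≠ []) : IsPath q ∧ FirstIn {u | Adj v u} q := by
  obtain ⟨-, hnd, hch⟩ := h
  have hch' : (v :: q).IsChain Adj := hch.right_of_append
  cases q with
  | nil => exact absurd rfl hq
  | cons b q =>
    rw [List.isChain_cons_cons] at hch'
    exact ⟨⟨hq, (List.nodup_append.1 hnd).2.1.of_cons, hch'.2⟩, b, hch'.1, rfl⟩

/-! ### Pivotal sites -/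

/-- If `s` contains a horizontal crossing but no two disjoint ones, then some vertex of a crossing
in `s` is the only vertex in `s` of a vertical crossing. -/
theorem UniqueHorizConn.exists_paths {n : ℤ} (hn : 0 ≤ n) {s : Finset Site}
    (hs : s ⊆ squareBox n) (h : UniqueHorizConn n s) :
    ∃ v p q₁ q₂, v ∈ p ∧ IsPath p ∧ (∀ u ∈ p, u ∈ s) ∧
      FirstIn {u | u.1 = -n} p ∧ LastIn {u | u.1 = n} p ∧
      IsPath (q₁ ++ v :: q₂) ∧ (∀ u ∈ q₁ ++ v :: q₂, u ≠ v → u ∈ squareBox n \ s) ∧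
      FirstIn {u | u.2 = -n} (q₁ ++ v :: q₂) ∧ LastIn {u | u.2 = n} (q₁ ++ v :: q₂) := by
  obtain ⟨hH, hD⟩ := h
  obtain ⟨v, hv⟩ : ∃ v, ¬ HorizConn n (s.erase v) := by
    by_contra! hcon
    exact hD (exists_disjoint_conn adj_symm s _ _ hH hcon)
  obtain ⟨p, hp, hps, hpL, hpR⟩ := hH.exists_isPath
  obtain ⟨q, hq, hqs, hqB, hqT⟩ := ((horizConn_or_vertConn hn
    ((Finset.erase_subset v s).trans hs)).resolve_left hv).exists_isPath
  have hvp : v ∈ p := by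
    by_contra hvp
    exact hv (hp.conn (fun u hu => Finset.mem_erase.2 ⟨fun e => hvp (e ▸ hu), hps u hu⟩) hpL hpR)
  have hqs' : ∀ u ∈ q, u ≠ v → u ∈ squareBox n \ s := by
    intro u hu huv
    have := hqs u hu
    simp only [Finset.mem_sdiff, Finset.mem_erase, not_and] at this ⊢
    exact ⟨this.1, this.2 huv⟩
  have hvq : v ∈ q := by
    by_contra hvq
    exact hH.not_vertConn hs (hq.conn (fun u hu => hqs' u hu fun e => hvq (e ▸ hu)) hqB hqT)
  obtain ⟨q₁, q₂, rfl⟩ := List.append_of_mem hvq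
  exact ⟨v, p, q₁, q₂, hvp, hp, hps, hpL, hpR, hq, hqs', hqB, hqT⟩

/-- A configuration in a square with a crossing but no two disjoint ones has a pivotal site in the
next larger square, provided four suitable sites just outside the square have the right state. -/
theorem UniqueHorizConn.exists_pivotal {n : ℤ} (hn : 0 ≤ n) {s : Finset Site}
    (hs : s ⊆ squareBox n) (h : UniqueHorizConn n s) :
    ∃ a b c d : Site, a ∉ squareBox n ∧ b ∉ squareBox n ∧ c ∉ squareBox n ∧ d ∉ squareBox n ∧
      a ≠ c ∧ a ≠ d ∧ b ≠ c ∧ b ≠ d ∧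
      ∀ ω : Config, (∀ u ∈ s, ω u = true) → (∀ u ∈ squareBox n \ s, ω u = false) →
        ω a = true → ω b = true → ω c = false → ω d = false → ∃ v, Pivotal (n + 1) ω v := by
  obtain ⟨v, p, q₁, q₂, hvp, hp, hps, hpL, hpR, hq, hqs, hqB, hqT⟩ := h.exists_paths hn hs
  have hpbox : ∀ u ∈ p, u ∈ squareBox n := fun u hu => hs (hps u hu)
  have hqbox : ∀ u ∈ q₁ ++ v :: q₂, u ∈ squareBox n := by
    intro u hu
    by_cases huv : u = v
    · exact huv ▸ hpbox v hvp
    · exact (Finset.mem_sdiff.1 (hqs u hu huv)).1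
  obtain ⟨⟨xa, ya⟩, hxa, ha⟩ := hpL
  obtain ⟨⟨xb, yb⟩, hxb, hb⟩ := hpR
  obtain ⟨⟨xc, yc⟩, hyc, hc⟩ := hqB
  obtain ⟨⟨xd, yd⟩, hyd, hd⟩ := hqT
  have ha' := mem_squareBox.1 (hpbox _ (List.mem_of_head? ha))
  have hb' := mem_squareBox.1 (hpbox _ (List.mem_of_getLast? hb))
  have hc' := mem_squareBox.1 (hqbox _ (List.mem_of_head? hc))
  have hd' := mem_squareBox.1 (hqbox _ (List.mem_of_getLast? hd))
  simp only [Set.mem_ofPred_eq] at hxa hxb hyc hyd ha' hb' hc' hd'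
  have hA : (-(n + 1), ya) ∉ squareBox n := by rw [mem_squareBox]; dsimp only; omega
  have hB : (n + 1, yb) ∉ squareBox n := by rw [mem_squareBox]; dsimp only; omega
  have hC : (xc, -(n + 1)) ∉ squareBox n := by rw [mem_squareBox]; dsimp only; omega
  have hD : (xd, n + 1) ∉ squareBox n := by rw [mem_squareBox]; dsimp only; omega
  have hP : IsPath ((-(n + 1), ya) :: (p ++ [(n + 1, yb)])) :=
    hp.extend (fun h => hA (hpbox _ h)) (fun h => hB (hpbox _ h))
      (by rw [ne_eq, Prod.mk.injEq]; omega)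
      ⟨_, adj_iff.2 (by dsimp only; omega), ha⟩ ⟨_, adj_iff.2 (by dsimp only; omega), hb⟩
  have hQ : IsPath ((xc, -(n + 1)) :: (q₁ ++ v :: q₂ ++ [(xd, n + 1)])) :=
    hq.extend (fun h => hC (hqbox _ h)) (fun h => hD (hqbox _ h))
      (by rw [ne_eq, Prod.mk.injEq]; omega)
      ⟨_, adj_iff.2 (by dsimp only; omega), hc⟩ ⟨_, adj_iff.2 (by dsimp only; omega), hd⟩
  have hQ₂ : IsPath (((xc, -(n + 1)) :: q₁) ++ v :: (q₂ ++ [(xd, n + 1)])) := by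
    simpa using hQ
  have hQ₁ : IsPath ((q₂ ++ [(xd, n + 1)]).reverse ++ v :: ((xc, -(n + 1)) :: q₁).reverse) := by
    simpa using hQ₂.reverse
  obtain ⟨hT, hT'⟩ := hQ₂.of_append_cons (by simp)
  obtain ⟨hS, hS'⟩ := hQ₁.of_append_cons (by simp)
  have hnd := hQ₂.2.1
  have hrect : ∀ u ∈ squareBox n, u ∈ rect (-(n + 1)) (n + 1) (-(n + 1)) (n + 1) := by
    intro u hu
    have := mem_squareBox.1 hu
    exact ⟨by omega, by omega, by omega, by omega⟩
  have hA' : (-(n + 1), ya) ∈ rect (-(n + 1)) (n + 1) (-(n + 1)) (n + 1) :=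
    ⟨by omega, by omega, by omega, by omega⟩
  have hB' : (n + 1, yb) ∈ rect (-(n + 1)) (n + 1) (-(n + 1)) (n + 1) :=
    ⟨by omega, by omega, by omega, by omega⟩
  have hC' : (xc, -(n + 1)) ∈ rect (-(n + 1)) (n + 1) (-(n + 1)) (n + 1) :=
    ⟨by omega, by omega, by omega, by omega⟩
  have hD' : (xd, n + 1) ∈ rect (-(n + 1)) (n + 1) (-(n + 1)) (n + 1) :=
    ⟨by omega, by omega, by omega, by omega⟩
  have ne : ∀ u ∈ q₁ ++ q₂, u ∈ squareBox n \ s := by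
    intro u hu
    refine hqs u (by simp at hu ⊢; tauto) ?_
    rintro rfl
    have := hq.2.1
    grind
  refine ⟨_, _, _, _, hA, hB, hC, hD, ?_, ?_, ?_, ?_, fun ω ho hcl h1 h2 h3 h4 => ⟨v,
    ⟨(-(n + 1), ya) :: (p ++ [(n + 1, yb)]), ⟨⟨hP, ?_⟩, ?_, ⟨_, ⟨hA', rfl⟩, rfl⟩,
      ⟨(n + 1, yb), ⟨hB', rfl⟩, ?_⟩⟩, ?_⟩,
    q₂ ++ [(xd, n + 1)], ((xc, -(n + 1)) :: q₁).reverse, ⟨hT, ?_⟩, ?_, hT',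
      ⟨_, ⟨hD', rfl⟩, by simp⟩, ⟨hS, ?_⟩, ?_, hS', ⟨_, ⟨hC', rfl⟩, by simp⟩, ?_⟩⟩
  · rw [ne_eq, Prod.mk.injEq]; omega
  · rw [ne_eq, Prod.mk.injEq]; omega
  · rw [ne_eq, Prod.mk.injEq]; omega
  · rw [ne_eq, Prod.mk.injEq]; omega
  · intro u hu
    simp only [List.mem_cons, List.mem_append, List.not_mem_nil, or_false] at hu
    rcases hu with rfl | hu | rfl
    exacts [hA', hrect u (hpbox u hu), hB']
  · intro u hu
    simp only [List.mem_cons, List.mem_append, List.not_mem_nil, or_false] at hu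
    rcases hu with rfl | hu | rfl
    exacts [h1, ho u (hps u hu), h2]
  · rw [← List.cons_append, List.getLast?_concat]
  · simp [hvp]
  · intro u hu
    simp only [List.mem_cons, List.mem_append, List.not_mem_nil, or_false] at hu
    rcases hu with hu | rfl
    exacts [hrect u (hqbox u (by simp [hu])), hD']
  · intro u hu
    simp only [List.mem_cons, List.mem_append, List.not_mem_nil, or_false] at hu
    rcases hu with hu | rfl
    exacts [hcl u (ne u (by simp [hu])), h4]
  · intro u hu
    simp only [List.mem_reverse, List.mem_cons] at hu
    rcases hu with rfl | hu
    exacts [hC', hrect u (hqbox u (by simp [hu]))]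
  · intro u hu
    simp only [List.mem_reverse, List.mem_cons] at hu
    rcases hu with rfl | hu
    exacts [h3, hcl u (ne u (by simp [hu]))]
  · intro u hu hu'
    rw [List.mem_reverse] at hu'
    exact (List.nodup_append.1 hnd).2.2 u hu' u (by simp [hu]) rfl

/-! ### The probability estimate -/

theorem measurableSet_cylinder (D : Finset Site) (f : Config) :
    MeasurableSet {ω : Config | ∀ v ∈ D, ω v = f v} := by
  have : {ω : Config | ∀ v ∈ D, ω v = f v} = ⋂ v ∈ D, (fun ω : Config => ω v) ⁻¹' {f v} := by
    ext ω
    simp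
  rw [this]
  exact Finset.measurableSet_biInter D fun v _ =>
    measurable_pi_apply v (MeasurableSet.singleton (f v))

theorem UniqueHorizConn.exists_cylinder {n : ℤ} (hn : 0 ≤ n) {s : Finset Site}
    (hs : s ⊆ squareBox n) (h : UniqueHorizConn n s) :
    ∃ (D : Finset Site) (f : Config), squareBox n ⊆ D ∧ D.card ≤ (squareBox n).card + 4 ∧
      (∀ u ∈ squareBox n, f u = true ↔ u ∈ s) ∧
      {ω : Config | ∀ u ∈ D, ω u = f u} ⊆ {ω | ∃ v, Pivotal (n + 1) ω v} := by
  classical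
  obtain ⟨a, b, c, d, ha, hb, hc, hd, hac, had, hbc, hbd, H⟩ := h.exists_pivotal hn hs
  refine ⟨squareBox n ∪ {a, b, c, d}, fun u => decide (u ∈ s ∨ u = a ∨ u = b),
    Finset.subset_union_left, (Finset.card_union_le _ _).trans
      (Nat.add_le_add_left Finset.card_le_four _), ?_, fun ω hω => ?_⟩
  · intro u hu
    have h1 : u ≠ a := fun e => ha (e ▸ hu)
    have h2 : u ≠ b := fun e => hb (e ▸ hu)
    simp [h1, h2]
  · have hcs : c ∉ s := fun h => hc (hs h)
    have hds : d ∉ s := fun h => hd (hs h)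
    refine H ω (fun u hu => ?_) (fun u hu => ?_) ?_ ?_ ?_ ?_
    · rw [hω u (by simp [hs hu])]
      simp [hu]
    · rw [Finset.mem_sdiff] at hu
      have h1 : u ≠ a := fun e => ha (e ▸ hu.1)
      have h2 : u ≠ b := fun e => hb (e ▸ hu.1)
      rw [hω u (by simp [hu.1])]
      simp [hu.2, h1, h2]
    · rw [hω a (by simp)]
      simp
    · rw [hω b (by simp)]
      simp
    · rw [hω c (by simp)]
      simp [hcs, hac.symm, hbc.symm]
    · rw [hω d (by simp)]
      simp [hds, had.symm, hbd.symm]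

theorem IsBernoulliHalf.le_measure_pivotal {μ : Measure Config} (hμ : IsBernoulliHalf μ) {n : ℤ}
    (hn : 0 ≤ n) : (1 / 2 : ℝ≥0∞) ^ 6 ≤ μ {ω | ∃ v, Pivotal (n + 1) ω v} := by
  classical
  set G := (squareBox n).powerset.filter (UniqueHorizConn n) with hG
  set k := (squareBox n).card with hk
  have hmem : ∀ s ∈ G, s ⊆ squareBox n ∧ UniqueHorizConn n s := fun s hs => by
    simpa [hG] using hs
  have key : ∀ s : Finset Site, ∃ (D : Finset Site) (f : Config), s ∈ G → squareBox n ⊆ D ∧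
      D.card ≤ k + 4 ∧ (∀ u ∈ squareBox n, f u = true ↔ u ∈ s) ∧
      {ω : Config | ∀ u ∈ D, ω u = f u} ⊆ {ω | ∃ v, Pivotal (n + 1) ω v} := by
    intro s
    by_cases hs : s ∈ G
    · obtain ⟨D, f, h⟩ := (hmem s hs).2.exists_cylinder hn (hmem s hs).1
      exact ⟨D, f, fun _ => h⟩
    · exact ⟨∅, fun _ => true, fun h => absurd h hs⟩
  choose D f h using key
  have hdisj : (G : Set (Finset Site)).PairwiseDisjoint
      fun s => {ω : Config | ∀ u ∈ D s, ω u = f s u} := by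
    intro s hs t ht hst
    refine Set.disjoint_left.2 fun ω hωs hωt => hst (Finset.ext fun u => ?_)
    obtain ⟨hDs, -, hfs, -⟩ := h s hs
    obtain ⟨hDt, -, hft, -⟩ := h t ht
    by_cases hu : u ∈ squareBox n
    · rw [← hfs u hu, ← hft u hu, ← hωs u (hDs hu), ← hωt u (hDt hu)]
    · exact ⟨fun h' => absurd ((hmem s hs).1 h') hu, fun h' => absurd ((hmem t ht).1 h') hu⟩
  have hcard : 2 ^ k ≤ 4 * G.card := two_pow_card_le_eventCard_uniqueHorizConn hn
  have hhalf : (1 / 2 : ℝ≥0∞) ≤ 1 := by simp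
  calc (1 / 2 : ℝ≥0∞) ^ 6
      = (2 ^ k * (1 / 2) ^ k) * (1 / 2 : ℝ≥0∞) ^ 6 := by
        rw [← mul_pow, one_div, ENNReal.mul_inv_cancel (by simp) (by simp), one_pow, one_mul]
    _ ≤ ((4 * G.card) * (1 / 2) ^ k) * (1 / 2 : ℝ≥0∞) ^ 6 := by
        gcongr
        exact_mod_cast hcard
    _ = (2 * (1 / 2)) ^ 2 * (G.card * (1 / 2 : ℝ≥0∞) ^ (k + 4)) := by ring
    _ = ∑ s ∈ G, (1 / 2 : ℝ≥0∞) ^ (k + 4) := by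
        rw [one_div, ENNReal.mul_inv_cancel (by simp) (by simp), one_pow, one_mul,
          Finset.sum_const, nsmul_eq_mul]
    _ ≤ ∑ s ∈ G, μ {ω : Config | ∀ u ∈ D s, ω u = f s u} := by
        refine Finset.sum_le_sum fun s hs => ?_
        rw [hμ.2]
        exact pow_le_pow_right_of_le_one' hhalf (h s hs).2.1
    _ = μ (⋃ s ∈ G, {ω : Config | ∀ u ∈ D s, ω u = f s u}) :=
        (measure_biUnion_finset hdisj fun s _ => measurableSet_cylinder _ _).symm
    _ ≤ μ {ω | ∃ v, Pivotal (n + 1) ω v} :=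
        measure_mono (Set.iUnion₂_subset fun s hs => (h s hs).2.2.2)

/-- There exists a constant `c > 0` such that
`P(there exists a pivotal site in B(r)) ≥ c` uniformly in `r ≥ 1`. -/
theorem statement12 :
    ∃ c : ℝ≥0∞, 0 < c ∧
      ∀ μ : Measure Config, IsBernoulliHalf μ →
        ∀ r : ℕ, 1 ≤ r →
          c ≤ μ {ω | ∃ v : Site, Pivotal (r : ℤ) ω v} := by
  refine ⟨(1 / 2) ^ 6, ENNReal.pow_pos (by simp) 6, fun μ hμ r hr => ?_⟩
  have h := hμ.le_measure_pivotal (n := (r : ℤ) - 1) (by omega)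
  rwa [sub_add_cancel] at h
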